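/- Let f be an infinite perfect field of characteristic p whose Brauer group has trivial 2-torsion, let k|f be a finite Galois extension, and let N be an F_p[Gal(k|f)]-module which has dimension two as a vector space over F_p. Then there is an F_p[Gal(k|f)]-submodule of k (with Gal(k|f) acting on k naturally and F_p ⊂ k acting by multiplication) which is isomorphic to N. -/

import Mathlib

/-!
STATEMENT 17 (Proposition 5.6 of the paper):
Let `f` be an infinite perfect field of characteristic `p` whose Brauer group has trivial
`2`-torsion, let `k|f` be a finite Galois extension, and let `N` be an
`F_p[Gal(k|f)]`-module of dimension two over `F_p`.  Then there is an
`F_p[Gal(k|f)]`-submodule of `k` (with the natural Galois action) isomorphic to `N`.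

Modelling: the triviality of the `2`-torsion of the Brauer group is expressed by: every
finite-dimensional central simple `f`-algebra `A` such that `A ⊗_f A` is split (isomorphic
to a matrix algebra over `f`) is itself split.  Since `k` has characteristic `p`, additive
subgroups of `k` are automatically `F_p`-subspaces and additive group isomorphisms are
automatically `F_p`-linear, so an `F_p[Gal(k|f)]`-submodule of `k` isomorphic to `N` is a
Galois-stable additive subgroup `S ≤ k` together with a Galois-equivariant additive
isomorphism `N ≃ S`.
-/

universe u

noncomputable section

/-- A finite-dimensional algebra over a field is split if it is isomorphic to a matrix
algebra over the base field. -/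
def IsSplitAlgebra (f A : Type*) [Field f] [Ring A] [Algebra f A] : Prop :=
  ∃ n : ℕ, 0 < n ∧ Nonempty (A ≃ₐ[f] Matrix (Fin n) (Fin n) f)

theorem two_dimensional_module_embeds_in_galois_extension
    (f : Type u) [Field f] (p : ℕ) (hp : p.Prime) (_ : CharP f p)
    (_ : Infinite f) (_ : PerfectField f)
    -- the Brauer group of `f` has trivial 2-torsion
    (hbr : ∀ (A : Type u) (_ : Ring A) (_ : Algebra f A), FiniteDimensional f A →
      Algebra.IsCentral f A → IsSimpleRing A →
      IsSplitAlgebra f (TensorProduct f A A) → IsSplitAlgebra f A)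
    -- `k|f` is a finite Galois extension
    (k : Type u) (_ : Field k) (_ : Algebra f k)
    (_ : FiniteDimensional f k) (_ : IsGalois f k)
    -- `N` is an `F_p[Gal(k|f)]`-module of dimension two over `F_p`
    (N : Type) (_ : AddCommGroup N) (_ : Module (ZMod p) N)
    (ρ : Representation (ZMod p) (k ≃ₐ[f] k) N)
    (hdim : Module.finrank (ZMod p) N = 2) :
    -- there is an `F_p[Gal(k|f)]`-submodule of `k` isomorphic to `N`
    ∃ S : AddSubgroup k,
      (∀ σ : k ≃ₐ[f] k, ∀ x ∈ S, σ x ∈ S) ∧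
      ∃ e : N ≃+ S, ∀ (σ : k ≃ₐ[f] k) (n : N),
        ((e (ρ σ n) : S) : k) = σ ((e n : S) : k) := by
  have : Fact p.Prime := ⟨hp⟩
  have hck : CharP k p := charP_of_injective_algebraMap (algebraMap f k).injective p
  have : Module.Finite (ZMod p) N := Module.finite_of_finrank_pos (by omega)
  have : Finite N := Module.finite_of_finite (ZMod p)
  let V : Submodule f (N → k) :=
    { carrier := {φ | (∀ a b, φ (a + b) = φ a + φ b) ∧
        ∀ (σ : k ≃ₐ[f] k) n, φ (ρ σ n) = σ (φ n)}
      add_mem' := by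
        rintro x y ⟨hx, hx'⟩ ⟨hy, hy'⟩
        refine ⟨fun a b => ?_, fun σ n => ?_⟩
        · simp only [Pi.add_apply, hx, hy]; ring
        · simp only [Pi.add_apply, hx', hy', map_add]
      zero_mem' := by constructor <;> simp
      smul_mem' := by
        rintro c x ⟨hx, hx'⟩
        refine ⟨fun a b => ?_, fun σ n => ?_⟩
        · simp only [Pi.smul_apply, hx, smul_add]
        · simp only [Pi.smul_apply, hx', map_smul] }
  let K : {n : N // n ≠ 0} → Subspace f V := fun n =>
    LinearMap.ker ((LinearMap.proj (R := f) (φ := fun _ : N => k) n.1).comp V.subtype)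
  -- each kernel is proper
  have hK : ∀ n, K n ≠ ⊤ := by
    rintro ⟨n, hn⟩ htop
    have hall : ∀ φ ∈ V, φ n = 0 := by
      intro φ hφ
      have : (⟨φ, hφ⟩ : V) ∈ K ⟨n, hn⟩ := by rw [htop]; trivial
      simpa [K] using this
    obtain ⟨l, hl⟩ : ∃ l : Module.Dual (ZMod p) N, l n ≠ 0 := by
      by_contra! h
      exact hn ((Module.forall_dual_apply_eq_zero_iff (ZMod p) n).1 h)
    let ι : ZMod p →+* k := ZMod.castHom dvd_rfl k
    have hι : ∀ (τ : k ≃ₐ[f] k) (z : ZMod p), τ (ι z) = ι z := fun τ z =>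
      RingHom.congr_fun (RingHom.ext_zmod ((τ : k →+* k).comp ι) ι) z
    have hsum : ∀ c : k, ∑ σ : k ≃ₐ[f] k, ι (l (ρ σ⁻¹ n)) * σ c = 0 := by
      intro c
      refine hall (fun m => ∑ σ : k ≃ₐ[f] k, ι (l (ρ σ⁻¹ m)) * σ c) ⟨fun a b => ?_, fun τ m => ?_⟩
      · simp only [map_add, add_mul, Finset.sum_add_distrib]
      · simp only [map_sum, map_mul, hι]
        rw [← Equiv.sum_comp (Equiv.mulLeft τ)]
        refine Finset.sum_congr rfl fun σ _ => ?_
        have : ρ (τ * σ)⁻¹ (ρ τ m) = ρ σ⁻¹ m := by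
          rw [← Module.End.mul_apply, ← map_mul]; congr 2; group
        simp only [Equiv.coe_mulLeft, this, AlgEquiv.mul_apply]
    have hli := (linearIndependent_monoidHom k k).comp
      (fun σ : k ≃ₐ[f] k => ((σ : k →+* k) : k →* k)) (by
        intro σ τ h
        ext x
        exact DFunLike.congr_fun h x)
    have := Fintype.linearIndependent_iff.1 hli (fun σ => ι (l (ρ σ⁻¹ n))) (by
      funext c
      simpa using hsum c) 1
    apply hl
    simpa using this
  obtain ⟨φ, hφ⟩ : ∃ φ : V, ∀ n, φ ∉ K n := by
    by_contra! h
    obtain ⟨n, hn⟩ := Subspace.exists_eq_top_of_iUnion_eq_univ (p := K) (by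
      ext φ; simpa using h φ)
    exact hK n hn
  let F : N →+ k := AddMonoidHom.mk' φ.1 φ.2.1
  have hF : Function.Injective F := by
    rw [injective_iff_map_eq_zero]
    intro n h0
    by_contra hn
    exact hφ ⟨n, hn⟩ (LinearMap.mem_ker.2 h0)
  refine ⟨F.range, ?_, AddMonoidHom.ofInjective hF, ?_⟩
  · rintro σ _ ⟨n, rfl⟩
    exact ⟨ρ σ n, φ.2.2 σ n⟩
  · intro σ n
    exact φ.2.2 σ n

end
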